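/- arXiv:1904.00953 — 2 statements merged into one kernel-verified Lean document; each statement's English description precedes it below -/
import Mathlib

section
/- Let (Tₙ) be a sequence of normal bounded operators of norm 1 on a complex separable Hilbert space H such that TₙTₘ = TₘTₙ for all n, m. Then (Tₙ) has a subsequence that converges in the weak operator topology to a normal bounded operator E that commutes with every Tₙ. -/
open Filter Topology
open scoped InnerProductSpace

/-- Cauchyness of an equi-Lipschitz sequence spreads from a dense sequence to all points. -/
theorem cauchy_of_dense_aux {H : Type*} [NormedAddCommGroup H] (g : ℕ → H → ℂ) (C : ℝ)
    (hC : 0 ≤ C)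
    (hg : ∀ k x y, ‖g k x - g k y‖ ≤ C * ‖x - y‖) (d : ℕ → H) (hd : DenseRange d)
    (hc : ∀ i, CauchySeq (fun k => g k (d i))) (x : H) : CauchySeq (fun k => g k x) := by
  rw [Metric.cauchySeq_iff]
  intro ε hε
  have hδ : 0 < ε / (3 * (C + 1)) := by positivity
  obtain ⟨i, hi⟩ := hd.exists_dist_lt x hδ
  obtain ⟨N, hN⟩ := Metric.cauchySeq_iff.1 (hc i) (ε / 3) (by positivity)
  refine ⟨N, fun m hm n hn => ?_⟩
  have h1 := hN m hm n hn
  have h2 : ∀ k, dist (g k x) (g k (d i)) < ε / 3 := by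
    intro k
    rw [dist_eq_norm]
    rw [dist_eq_norm] at hi
    calc _ ≤ C * ‖x - d i‖ := hg k x (d i)
      _ ≤ C * (ε / (3 * (C + 1))) := by gcongr
      _ < (C + 1) * (ε / (3 * (C + 1))) := by nlinarith
      _ = ε / 3 := by field_simp
  have h3 := h2 m
  have h4 := h2 n
  rw [dist_comm] at h4
  have h5 := dist_triangle4 (g m x) (g m (d i)) (g n (d i)) (g n x)
  linarith

/-- Sequential weak operator compactness of the unit ball. -/
theorem wot_subseq_aux
    {H : Type*} [NormedAddCommGroup H] [InnerProductSpace ℂ H] [CompleteSpace H]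
    [TopologicalSpace.SeparableSpace H]
    (T : ℕ → (H →L[ℂ] H)) (hnorm : ∀ n, ‖T n‖ = 1) :
    ∃ h : ℕ → ℕ, StrictMono h ∧ ∃ E : H →L[ℂ] H,
      ∀ ξ η : H, Tendsto (fun k => ⟪(T (h k)) ξ, η⟫_ℂ) atTop (𝓝 ⟪E ξ, η⟫_ℂ) := by
  have hb : ∀ n x y, ‖⟪T n x, y⟫_ℂ‖ ≤ ‖x‖ * ‖y‖ := by
    intro n x y
    refine (norm_inner_le_norm _ _).trans ?_
    have := (T n).le_opNorm x
    rw [hnorm, one_mul] at this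
    gcongr
  let d := TopologicalSpace.denseSeq H
  have hd : DenseRange d := TopologicalSpace.denseRange_denseSeq H
  let F : ℕ → (ℕ × ℕ → ℂ) := fun n p => ⟪T n (d p.1), d p.2⟫_ℂ
  have hK : IsCompact (Set.pi Set.univ
      (fun p : ℕ × ℕ => Metric.closedBall (0 : ℂ) (‖d p.1‖ * ‖d p.2‖))) :=
    isCompact_univ_pi fun p => isCompact_closedBall _ _
  obtain ⟨a, -, h, hh, ha⟩ := hK.isSeqCompact (x := F) (by
    intro n p _
    simpa [F] using hb n (d p.1) (d p.2))
  refine ⟨h, hh, ?_⟩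
  rw [tendsto_pi_nhds] at ha
  have c1 : ∀ i η, CauchySeq (fun k => ⟪T (h k) (d i), η⟫_ℂ) := by
    intro i η
    refine cauchy_of_dense_aux (fun k η => ⟪T (h k) (d i), η⟫_ℂ) ‖d i‖ (norm_nonneg _) ?_ d hd ?_ η
    · intro k x y
      rw [← inner_sub_right]
      exact hb _ _ _
    · intro j
      exact (ha (i, j)).cauchySeq
  have c2 : ∀ ξ η, CauchySeq (fun k => ⟪T (h k) ξ, η⟫_ℂ) := by
    intro ξ η
    refine cauchy_of_dense_aux (fun k ξ => ⟪T (h k) ξ, η⟫_ℂ) ‖η‖ (norm_nonneg _) ?_ d hd ?_ ξ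
    · intro k x y
      rw [← inner_sub_left, ← map_sub, mul_comm]
      exact hb _ _ _
    · intro j
      exact c1 j η
  choose L hL using fun ξ η => cauchySeq_tendsto_of_complete (c2 ξ η)
  let B : H →ₗ⋆[ℂ] H →ₗ[ℂ] ℂ := LinearMap.mk₂'ₛₗ (starRingEnd ℂ) (RingHom.id ℂ) L
    (fun x y z => tendsto_nhds_unique (hL _ _) (by
      simpa [inner_add_left] using (hL x z).add (hL y z)))
    (fun c x z => tendsto_nhds_unique (hL _ _) (by
      simpa [inner_smul_left, mul_comm] using (hL x z).const_mul (starRingEnd ℂ c)))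
    (fun x y z => tendsto_nhds_unique (hL _ _) (by
      simpa [inner_add_right] using (hL x y).add (hL x z)))
    (fun c x z => tendsto_nhds_unique (hL _ _) (by
      simpa [inner_smul_right] using (hL x z).const_mul c))
  let B' : H →L⋆[ℂ] H →L[ℂ] ℂ := B.mkContinuous₂ 1 (fun x y => by
    rw [one_mul]
    exact le_of_tendsto (hL x y).norm (Eventually.of_forall fun k => hb _ _ _))
  refine ⟨InnerProductSpace.continuousLinearMapOfBilin B', fun ξ η => ?_⟩
  rw [InnerProductSpace.continuousLinearMapOfBilin_apply]
  exact hL ξ η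

/-- A commuting sequence of normal operators of norm `1` on a complex separable Hilbert
space has a subsequence converging, in the weak operator topology, to a normal operator
commuting with every operator of the sequence. -/
theorem weak_limit_of_commuting_normal_operators
    {H : Type*} [NormedAddCommGroup H] [InnerProductSpace ℂ H] [CompleteSpace H]
    [TopologicalSpace.SeparableSpace H]
    (T : ℕ → (H →L[ℂ] H))
    (hnormal : ∀ n, IsStarNormal (T n))
    (hnorm : ∀ n, ‖T n‖ = 1)
    (hcomm : ∀ n m, Commute (T n) (T m)) :
    ∃ h : ℕ → ℕ, StrictMono h ∧ ∃ E : H →L[ℂ] H, IsStarNormal E ∧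
      (∀ n, Commute E (T n)) ∧
      ∀ ξ η : H, Tendsto (fun k => ⟪(T (h k)) ξ, η⟫_ℂ) atTop (𝓝 ⟪E ξ, η⟫_ℂ) := by
  obtain ⟨h, hh, E, hE⟩ := wot_subseq_aux T hnorm
  have key : ∀ S : H →L[ℂ] H, (∀ n, Commute S (T n)) → Commute S E := by
    intro S hS
    refine ContinuousLinearMap.ext fun ξ => ext_inner_right ℂ fun η => ?_
    have h1 := hE (S ξ) η
    have h2 := hE ξ (ContinuousLinearMap.adjoint S η)
    simp only [ContinuousLinearMap.adjoint_inner_right] at h2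
    refine tendsto_nhds_unique h2 (h1.congr fun k => ?_)
    have := congrArg (fun A : H →L[ℂ] H => ⟪A ξ, η⟫_ℂ) (hS (h k)).eq
    exact this.symm
  have hET : ∀ n, Commute E (T n) := fun n => (key (T n) (hcomm n)).symm
  have hstar : ∀ n, Commute (star E) (T n) := by
    intro n
    have h1 : Commute E (star (T n)) := (hnormal n).commute_star_right (hET n)
    simpa using h1.star_star
  exact ⟨h, hh, E, ⟨key _ hstar⟩, hET, hE⟩
end

section
/- Let G₁, …, G_N be topological groups such that each Gᵢ has a Cartan decomposition (K_{i,1}, Aᵢ⁺, K_{i,2}) and (Gᵢ, Aᵢ⁺) has the Mautner property relative to {Gᵢ}. Then in G := G₁ × ⋯ × G_N, the triple (K_{1,1} × ⋯ × K_{N,1}, A₁⁺ × ⋯ × A_N⁺, K_{1,2} × ⋯ × K_{N,2}) is a Cartan decomposition of G, and (G, A₁⁺ × ⋯ × A_N⁺) has the Mautner property relative to the family {G₁, …, G_N} (each Gᵢ identified with the subgroup {e} × ⋯ × Gᵢ × ⋯ × {e} of G). -/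
open Filter Topology

/-- The positive contracting subgroup associated to a sequence `a` in `G`. -/
def posContracting {G : Type*} [Group G] [TopologicalSpace G] (a : ℕ → G) : Set G :=
  {g : G | Tendsto (fun n => (a n)⁻¹ * g * a n) atTop (𝓝 1)}

/-- The negative contracting subgroup associated to a sequence `a` in `G`. -/
def negContracting {G : Type*} [Group G] [TopologicalSpace G] (a : ℕ → G) : Set G :=
  {g : G | Tendsto (fun n => a n * g * (a n)⁻¹) atTop (𝓝 1)}

/-- `(K₁, A⁺, K₂)` is a Cartan decomposition of `G`. -/
def IsCartanDecomposition {G : Type*} [Group G] [TopologicalSpace G]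
    (K₁ A K₂ : Set G) : Prop :=
  IsCompact K₁ ∧ IsCompact K₂ ∧
    (∀ a₁ ∈ A, ∀ a₂ ∈ A, a₁ * a₂ = a₂ * a₁ ∧ a₁ * a₂ ∈ A) ∧
    (∀ g : G, ∃ k₁ ∈ K₁, ∃ a ∈ A, ∃ k₂ ∈ K₂, g = k₁ * a * k₂)

/-- `(G, A)` has the Mautner property relative to a set `F` of subgroups of `G`. -/
def MautnerPropertyRel {G : Type*} [Group G] [TopologicalSpace G]
    (A : Set G) (F : Set (Subgroup G)) : Prop :=
  ∀ a : ℕ → G, (∀ n, a n ∈ A) → Tendsto a atTop (cocompact G) →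
    ∃ F₀ ∈ F, ∃ h : ℕ → ℕ, StrictMono h ∧
      (F₀ : Set G) ⊆
        closure (Subgroup.closure (posContracting (a ∘ h) ∪ negContracting (a ∘ h)) : Set G)

theorem exists_subseq_escape
    {N : ℕ} {G : Fin N → Type*} [∀ i, TopologicalSpace (G i)] (a : ℕ → ∀ i, G i)
    (ha : Tendsto a atTop (cocompact (∀ i, G i))) :
    ∃ i, ∃ h : ℕ → ℕ, StrictMono h ∧ Tendsto (fun n => a (h n) i) atTop (cocompact (G i)) := by
  classical
  by_contra hcon
  push Not at hcon
  have key : ∀ s : Finset (Fin N), ∃ h : ℕ → ℕ, StrictMono h ∧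
      ∀ i ∈ s, ∃ K : Set (G i), IsCompact K ∧ ∀ n, a (h n) i ∈ K := by
    intro s
    induction s using Finset.induction_on with
    | empty => exact ⟨id, strictMono_id, by simp⟩
    | insert j s hj ih =>
      obtain ⟨h, hh, hK⟩ := ih
      have h1 := hcon j h hh
      rw [(hasBasis_cocompact).tendsto_right_iff] at h1
      push Not at h1
      obtain ⟨K, hKc, hf⟩ := h1
      obtain ⟨φ, hφ, hφK⟩ := extraction_of_frequently_atTop hf
      refine ⟨h ∘ φ, hh.comp hφ, ?_⟩
      intro i hi
      rcases Finset.mem_insert.1 hi with rfl | hi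
      · exact ⟨K, hKc, fun n => by simpa using hφK n⟩
      · obtain ⟨L, hL, hL'⟩ := hK i hi
        exact ⟨L, hL, fun n => hL' _⟩
  obtain ⟨h, hh, hK⟩ := key Finset.univ
  choose K hKc hKm using fun i => hK i (Finset.mem_univ i)
  have h2 := (ha.comp hh.tendsto_atTop).eventually
    ((isCompact_univ_pi hKc).compl_mem_cocompact)
  obtain ⟨n, hn⟩ := h2.exists
  exact hn (fun i _ => hKm i n)

theorem tendsto_mulSingle_one
    {N : ℕ} {G : Fin N → Type*} [∀ i, Group (G i)] [∀ i, TopologicalSpace (G i)]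
    (i : Fin N) (u : ℕ → G i) (hu : Tendsto u atTop (𝓝 1)) :
    Tendsto (fun n => (Pi.mulSingle i (u n) : ∀ i, G i)) atTop (𝓝 1) := by
  have := ((continuous_mulSingle (A := G) i).tendsto 1).comp hu
  simpa [Pi.mulSingle_one, Function.comp_def] using this

theorem conj_mulSingle
    {N : ℕ} {G : Fin N → Type*} [∀ i, Group (G i)]
    (i : Fin N) (a b : ∀ i, G i) (hab : a * b = 1) (g : G i) :
    a * Pi.mulSingle i g * b = Pi.mulSingle i (a i * g * b i) := by
  ext j
  by_cases hj : j = i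
  · subst hj; simp
  · have := congrFun hab j
    simpa [hj] using this

/-- If each `Gᵢ` has a Cartan decomposition `(K_{i,1}, Aᵢ⁺, K_{i,2})` with the Mautner
property, then the product of these triples is a Cartan decomposition of
`G := G₁ × ⋯ × G_N` and `(G, A₁⁺ × ⋯ × A_N⁺)` has the Mautner property relative to the
family `{G₁, …, G_N}` of factor subgroups of `G`. -/
theorem product_cartan_mautner
    {N : ℕ} {G : Fin N → Type*} [∀ i, Group (G i)] [∀ i, TopologicalSpace (G i)]
    (K₁ A K₂ : ∀ i, Set (G i))
    (hCartan : ∀ i, IsCartanDecomposition (K₁ i) (A i) (K₂ i))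
    (hMautner : ∀ i, MautnerPropertyRel (A i) {(⊤ : Subgroup (G i))}) :
    IsCartanDecomposition (G := ∀ i, G i)
        (Set.univ.pi K₁) (Set.univ.pi A) (Set.univ.pi K₂) ∧
      MautnerPropertyRel (G := ∀ i, G i) (Set.univ.pi A)
        (Set.range fun i : Fin N => (MonoidHom.mulSingle G i).range) := by
  refine ⟨⟨isCompact_univ_pi fun i => (hCartan i).1, isCompact_univ_pi fun i => (hCartan i).2.1,
    ?_, ?_⟩, ?_⟩
  · intro a ha b hb
    exact ⟨funext fun i => ((hCartan i).2.2.1 _ (ha i trivial) _ (hb i trivial)).1,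
      fun i _ => ((hCartan i).2.2.1 _ (ha i trivial) _ (hb i trivial)).2⟩
  · intro g
    choose k₁ h₁ a ha k₂ h₂ hg using fun i => (hCartan i).2.2.2 (g i)
    exact ⟨k₁, fun i _ => h₁ i, a, fun i _ => ha i, k₂, fun i _ => h₂ i, funext hg⟩
  · intro a haA ha
    obtain ⟨i, h, hh, hi⟩ := exists_subseq_escape a ha
    obtain ⟨F₀, hF, h', hh', hsub⟩ :=
      hMautner i (fun n => a (h n) i) (fun n => haA (h n) i trivial) hi
    rw [Set.mem_singleton_iff] at hF
    subst hF
    refine ⟨_, ⟨i, rfl⟩, h ∘ h', hh.comp hh', ?_⟩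
    rintro _ ⟨g, rfl⟩
    have hcont : Continuous (MonoidHom.mulSingle G i) := continuous_mulSingle (A := G) i
    have hg := hsub (show g ∈ ((⊤ : Subgroup (G i)) : Set (G i)) from trivial)
    have h3 := image_closure_subset_closure_image hcont ⟨g, hg, rfl⟩
    refine closure_mono ?_ h3
    rw [← Subgroup.coe_map, MonoidHom.map_closure]
    refine SetLike.coe_subset_coe.2 (Subgroup.closure_mono ?_)
    rintro _ ⟨x, hx | hx, rfl⟩
    · left
      have := tendsto_mulSingle_one i _ hx
      refine this.congr fun n => ?_
      exact (conj_mulSingle i (a (h (h' n)))⁻¹ (a (h (h' n))) (inv_mul_cancel _) x).symm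
    · right
      have := tendsto_mulSingle_one i _ hx
      refine this.congr fun n => ?_
      exact (conj_mulSingle i (a (h (h' n))) (a (h (h' n)))⁻¹ (mul_inv_cancel _) x).symm
end
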